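/- Let F : ℝ^n → ℝ^n be a coherently oriented piecewise affine function. Then all regular values of F have the same (finite) number of preimages: there is a natural number k such that for every regular value y of F, the set F⁻¹(y) has exactly k elements. -/

import Mathlib

open Set Filter Bornology

noncomputable section

/-- A (closed convex) polyhedron in `ℝⁿ`: a finite intersection of closed halfspaces. -/
def IsPolyhedron {n : ℕ} (P : Set (Fin n → ℝ)) : Prop :=
  ∃ (m : ℕ) (a : Fin m → (Fin n → ℝ)) (c : Fin m → ℝ),
    P = {x | ∀ i, (∑ j, a i j * x j) ≤ c i}

/-- `G` is a proper face of the polyhedron `P`: `G ≠ P` and `G` is either empty or the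
intersection of `P` with a supporting hyperplane. -/
def IsProperFaceOf {n : ℕ} (G P : Set (Fin n → ℝ)) : Prop :=
  G ≠ P ∧ (G = ∅ ∨ ∃ (a : Fin n → ℝ) (c : ℝ),
    (∀ x ∈ P, (∑ j, a j * x j) ≤ c) ∧ G = {x ∈ P | (∑ j, a j * x j) = c})

/-- The affine map `x ↦ A x + b` encoded by the pair `p = (A, b)`. -/
def affMap {n : ℕ} (p : Matrix (Fin n) (Fin n) ℝ × (Fin n → ℝ)) :
    (Fin n → ℝ) → (Fin n → ℝ) :=
  fun x => p.1.mulVec x + p.2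

/-- The selection function `p` is active (for `F`) on the set `U`. -/
def ActiveOn {n : ℕ} (F : (Fin n → ℝ) → (Fin n → ℝ))
    (p : Matrix (Fin n) (Fin n) ℝ × (Fin n → ℝ)) (U : Set (Fin n → ℝ)) : Prop :=
  ∀ x ∈ U, F x = affMap p x

/-- `F` is piecewise affine with (finite) set of selection functions `S`. -/
def IsPWA {n : ℕ} (F : (Fin n → ℝ) → (Fin n → ℝ))
    (S : Finset (Matrix (Fin n) (Fin n) ℝ × (Fin n → ℝ))) : Prop :=
  Continuous F ∧ ∀ x, ∃ p ∈ S, F x = affMap p x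

/-- `𝒞` is a polyhedral subdivision of `ℝⁿ` corresponding to the piecewise affine `F`
with selection functions `S`. -/
def IsSubdivision {n : ℕ} (F : (Fin n → ℝ) → (Fin n → ℝ))
    (S : Finset (Matrix (Fin n) (Fin n) ℝ × (Fin n → ℝ)))
    (𝒞 : Set (Set (Fin n → ℝ))) : Prop :=
  𝒞.Finite ∧
  (∀ P ∈ 𝒞, IsPolyhedron P ∧ (interior P).Nonempty) ∧
  ⋃₀ 𝒞 = univ ∧
  (∀ P ∈ 𝒞, ∃ p ∈ S, ActiveOn F p P) ∧
  (∀ P ∈ 𝒞, ∀ Q ∈ 𝒞, P ≠ Q →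
    P ∩ Q = ∅ ∨ (IsProperFaceOf (P ∩ Q) P ∧ IsProperFaceOf (P ∩ Q) Q))

/-- `F` is nonsingular at infinity w.r.t. the subdivision `𝒞`: every selection function
active on an unbounded polyhedron of `𝒞` has invertible linear part. -/
def NonsingularAtInfinity {n : ℕ} (F : (Fin n → ℝ) → (Fin n → ℝ))
    (S : Finset (Matrix (Fin n) (Fin n) ℝ × (Fin n → ℝ)))
    (𝒞 : Set (Set (Fin n → ℝ))) : Prop :=
  ∀ p ∈ S, ∀ P ∈ 𝒞, ¬ IsBounded P → ActiveOn F p P → p.1.det ≠ 0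

/-- `y` is a regular value of `F`. -/
def IsRegularValue {n : ℕ} (F : (Fin n → ℝ) → (Fin n → ℝ)) (y : Fin n → ℝ) : Prop :=
  ∀ x, F x = y → DifferentiableAt ℝ F x ∧ (fderiv ℝ F x).det ≠ 0

/-- The signed count of preimages of `y` under `F`. -/
def degSum {n : ℕ} (F : (Fin n → ℝ) → (Fin n → ℝ)) (y : Fin n → ℝ) : ℝ :=
  ∑ᶠ x ∈ F ⁻¹' {y}, Real.sign ((fderiv ℝ F x).det)

open Topology MeasureTheory Module

/-- `F` agrees with a self-homeomorphism of the space in a neighbourhood of `x`. -/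
def HasHomeoGermAt {X Y : Type*} [TopologicalSpace X] [TopologicalSpace Y]
    (F : X → Y) (x : X) : Prop :=
  ∃ G : X ≃ₜ Y, F =ᶠ[𝓝 x] G

/-- The number of preimages under a closed map is locally constant around a value all of whose
preimages have neighbourhoods on which the map agrees with a homeomorphism. -/
theorem IsClosedMap.eventually_ncard_fiber_eq {X Y : Type*} [TopologicalSpace X] [T2Space X]
    [TopologicalSpace Y] {F : X → Y} (hF : IsClosedMap F) {y : Y} (hfin : (F ⁻¹' {y}).Finite)
    (hy : ∀ x, F x = y → HasHomeoGermAt F x) :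
    ∀ᶠ y' in 𝓝 y, (F ⁻¹' {y'}).ncard = (F ⁻¹' {y}).ncard := by
  obtain ⟨U, hU, hdisj⟩ := hfin.t2_separation
  have hy' : ∀ x : X, ∃ (G : X → Y) (H : Y → X) (O : Set X), F x = y →
      (IsOpen O ∧ x ∈ O ∧ O ⊆ U x ∧ (∀ z ∈ O, F z = G z) ∧ (∀ z, G (H z) = z) ∧
        (∀ z, H (G z) = z) ∧ Continuous H) := by
    intro x
    by_cases hx : F x = y
    · obtain ⟨G, hG⟩ := hy x hx
      obtain ⟨O, hO, hOo, hxO⟩ := mem_nhds_iff.1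
        (inter_mem hG ((hU x).2.mem_nhds (hU x).1))
      exact ⟨G, G.symm, O, fun _ => ⟨hOo, hxO, fun z hz => (hO hz).2, fun z hz => (hO hz).1,
        G.apply_symm_apply, G.symm_apply_apply, G.symm.continuous⟩⟩
    · exact ⟨fun _ => y, fun _ => x, ∅, fun h => absurd h hx⟩
  choose G H O hO using hy'
  have h₁ : ∀ᶠ y' in 𝓝 y, ∀ x ∈ F ⁻¹' {y'}, ∃ z, F z = y ∧ x ∈ O z := by
    refine hF.eventually_nhds_fiber y fun x hx => ?_
    filter_upwards [(hO x hx).1.mem_nhds (hO x hx).2.1] with z hz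
    exact ⟨x, hx, hz⟩
  have h₂ : ∀ᶠ y' in 𝓝 y, ∀ x ∈ F ⁻¹' {y}, H x y' ∈ O x := by
    refine (hfin.eventually_all).2 fun x hx => ?_
    obtain ⟨hOo, hxO, -, hFG, -, hHG, hHc⟩ := hO x hx
    refine hHc.continuousAt.eventually_mem (hOo.mem_nhds ?_)
    have hx' : F x = y := hx
    rw [← hx', hFG x hxO, hHG]
    exact hxO
  filter_upwards [h₁, h₂] with y' h₁ h₂
  symm
  refine ncard_congr (fun x _ => H x y') ?_ ?_ ?_
  · intro x hx
    obtain ⟨-, -, -, hFG, hGH, -, -⟩ := hO x hx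
    change F (H x y') = y'
    rw [hFG _ (h₂ x hx), hGH]
  · intro a b ha hb hab
    by_contra hne
    have := (hdisj ha hb hne)
    refine Set.disjoint_left.1 this ((hO a ha).2.2.1 (h₂ a ha)) ?_
    rw [hab]
    exact (hO b hb).2.2.1 (h₂ b hb)
  · intro x hx
    obtain ⟨z, hz, hxz⟩ := h₁ x hx
    refine ⟨z, hz, ?_⟩
    obtain ⟨-, -, -, hFG, -, hHG, -⟩ := hO z hz
    have hx' : F x = y' := hx
    rw [← hx', hFG x hxz, hHG]

section Fold

variable {E : Type*} [NormedAddCommGroup E] [NormedSpace ℝ E] [FiniteDimensional ℝ E]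

theorem exists_homeomorph_add_max_smul (l : E →ₗ[ℝ] ℝ) (w : E) (h : 0 < 1 + l w) :
    ∃ G : E ≃ₜ E, ∀ v, G v = v + max (l v) 0 • w := by
  have hl : Continuous l := l.continuous_of_finiteDimensional
  refine ⟨⟨⟨fun v => v + max (l v) 0 • w, fun v => v - (max (l v) 0 / (1 + l w)) • w, ?_, ?_⟩,
    by fun_prop, by fun_prop⟩, fun v => rfl⟩
  · intro v
    rcases le_total 0 (l v) with hv | hv
    · have : l v + l v * l w = l v * (1 + l w) := by ring
      have h2 : 0 ≤ l v * (1 + l w) := by positivity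
      simp [max_eq_left hv, this, max_eq_left h2, h.ne']
    · simp [max_eq_right hv]
  · intro v
    rcases le_total 0 (l v) with hv | hv
    · have : l v - l v / (1 + l w) * l w = l v / (1 + l w) := by field_simp; ring
      have h2 : 0 ≤ l v / (1 + l w) := by positivity
      simp [max_eq_left hv, this, max_eq_left h2]
    · simp [max_eq_right hv]

/-- Two linear automorphisms of the same orientation which agree on a hyperplane can be glued
along this hyperplane to a homeomorphism. -/
theorem exists_homeomorph_glue (f g : E →ₗ[ℝ] E) (hdet : 0 < f.det * g.det) (l : E →ₗ[ℝ] ℝ)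
    (hfg : ∀ v, l v = 0 → f v = g v) :
    ∃ G : E ≃ₜ E, (∀ v, 0 ≤ l v → G v = f v) ∧ ∀ v, l v ≤ 0 → G v = g v := by
  have hg : g.det ≠ 0 := right_ne_zero_of_mul hdet.ne'
  let e : E ≃ₗ[ℝ] E := LinearMap.equivOfDetNeZero g hg
  have he : ∀ v, e v = g v := fun v => rfl
  obtain ⟨w, hw⟩ : ∃ w, ∀ v, f v = g (v + l v • w) := by
    by_cases hl : ∃ u, l u ≠ 0
    · obtain ⟨u, hu⟩ := hl
      refine ⟨(l u)⁻¹ • e.symm (f u - g u), fun v => ?_⟩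
      have h1 := hfg (v - (l v * (l u)⁻¹) • u) (by simp [hu])
      have h2 : g (e.symm (f u - g u)) = f u - g u := by rw [← he, e.apply_symm_apply]
      simp only [map_sub, map_smul, sub_eq_iff_eq_add] at h1
      simp only [map_add, LinearMap.map_smul, h2, smul_smul]
      rw [h1]
      module
    · push Not at hl
      exact ⟨0, fun v => by simpa using hfg v (hl v)⟩
  have hf : f = g ∘ₗ LinearMap.transvection l w := by
    ext v
    simp [hw v, LinearMap.transvection.apply]
  have hpos : 0 < 1 + l w := by
    rw [hf, LinearMap.det_comp, LinearMap.transvection.det] at hdet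
    have : 0 < g.det * g.det := mul_self_pos.2 hg
    nlinarith
  obtain ⟨G, hG⟩ := exists_homeomorph_add_max_smul l w hpos
  refine ⟨G.trans e.toContinuousLinearEquiv.toHomeomorph, fun v hv => ?_, fun v hv => ?_⟩
  · simp [hG, hw v, max_eq_left hv, he]
  · simp [hG, max_eq_right hv, he]

end Fold

section Thin

variable {E : Type*} [NormedAddCommGroup E] [NormedSpace ℝ E] [FiniteDimensional ℝ E]

/-- A set contained in an affine subspace of codimension at least two. -/
def IsThin (M : Set E) : Prop :=
  ∃ V : Submodule ℝ E, finrank ℝ V + 2 ≤ finrank ℝ E ∧ ∀ x ∈ M, ∀ y ∈ M, x - y ∈ V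

theorem ae_sub_notMem_submodule [MeasurableSpace E] [BorelSpace E] (μ : Measure E)
    [μ.IsAddHaarMeasure] (V : Submodule ℝ E) (hV : finrank ℝ V < finrank ℝ E) (y : E) :
    ∀ᵐ z ∂μ, z - y ∉ V := by
  have h0 : μ (V : Set E) = 0 := by
    refine Measure.addHaar_submodule μ V ?_
    rintro rfl
    simp at hV
  have h1 : μ ((fun z => z + (-y)) ⁻¹' (V : Set E)) = 0 := by
    rw [measure_preimage_add_right, h0]
  rw [ae_iff]
  simp only [not_not, sub_eq_add_neg]
  exact h1

theorem IsThin.ae_notMem [MeasurableSpace E] [BorelSpace E] (μ : Measure E)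
    [μ.IsAddHaarMeasure] {M : Set E} (hM : IsThin M) : ∀ᵐ z ∂μ, z ∉ M := by
  obtain ⟨V, hV, h⟩ := hM
  rcases M.eq_empty_or_nonempty with rfl | ⟨m, hm⟩
  · simp
  · filter_upwards [ae_sub_notMem_submodule μ V (by lia) m] with z hz hzM
    exact hz (h z hzM m hm)

theorem IsThin.ae_disjoint_segment [MeasurableSpace E] [BorelSpace E] (μ : Measure E)
    [μ.IsAddHaarMeasure] {M : Set E} (hM : IsThin M) {y : E} (hy : y ∉ M) :
    ∀ᵐ z ∂μ, Disjoint (segment ℝ y z) M := by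
  obtain ⟨V, hV, h⟩ := hM
  rcases M.eq_empty_or_nonempty with rfl | ⟨m, hm⟩
  · simp
  have hfr : finrank ℝ (V ⊔ Submodule.span ℝ {m - y} : Submodule ℝ E) < finrank ℝ E := by
    have h1 := Submodule.finrank_add_le_finrank_add_finrank V (Submodule.span ℝ {m - y})
    have h2 := finrank_span_le_card (R := ℝ) ({m - y} : Set E)
    simp only [toFinset_singleton, Finset.card_singleton] at h2
    lia
  filter_upwards [ae_sub_notMem_submodule μ _ hfr y] with z hz
  rw [Set.disjoint_left]
  intro u hu huM
  rw [segment_eq_image'] at hu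
  obtain ⟨t, -, rfl⟩ := hu
  rcases eq_or_ne t 0 with rfl | ht
  · simp at huM
    exact hy huM
  · apply hz
    have h1 := h _ huM m hm
    have h3 : z - y = t⁻¹ • ((y + t • (z - y) - m) + (m - y)) := by
      rw [sub_add_sub_cancel, add_sub_cancel_left, smul_smul, inv_mul_cancel₀ ht, one_smul]
    rw [h3]
    exact Submodule.smul_mem _ _ (Submodule.add_mem_sup h1 (Submodule.mem_span_singleton_self _))

theorem IsThin.image {M : Set E} (hM : IsThin M) (f : E → E) (g : E →ₗ[ℝ] E)
    (hfg : ∀ x y, f x - f y = g (x - y)) : IsThin (f '' M) := by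
  obtain ⟨V, hV, h⟩ := hM
  refine ⟨V.map g, by have := Submodule.finrank_map_le g V; lia, ?_⟩
  rintro _ ⟨x, hx, rfl⟩ _ ⟨y, hy, rfl⟩
  rw [hfg]
  exact Submodule.mem_map_of_mem (h x hx y hy)

end Thin

section Affine

variable {n : ℕ} {F : (Fin n → ℝ) → (Fin n → ℝ)}
  {S : Finset (Matrix (Fin n) (Fin n) ℝ × (Fin n → ℝ))}
  {p q r s : Matrix (Fin n) (Fin n) ℝ × (Fin n → ℝ)} {x : Fin n → ℝ}

theorem affMap_sub_affMap (p : Matrix (Fin n) (Fin n) ℝ × (Fin n → ℝ)) (x y : Fin n → ℝ) :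
    affMap p x - affMap p y = p.1.toLin' (x - y) := by
  simp [affMap, Matrix.mulVec_sub]

theorem affMap_eq_add (p : Matrix (Fin n) (Fin n) ℝ × (Fin n → ℝ)) (x z : Fin n → ℝ) :
    affMap p z = affMap p x + p.1.toLin' (z - x) := by
  rw [← affMap_sub_affMap, add_sub_cancel]

theorem continuous_affMap (p : Matrix (Fin n) (Fin n) ℝ × (Fin n → ℝ)) :
    Continuous (affMap p) :=
  (p.1.toLin'.continuous_of_finiteDimensional).add continuous_const

theorem hasHomeoGermAt_of_eventually_eq_add {G : (Fin n → ℝ) ≃ₜ (Fin n → ℝ)}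
    (h : ∀ᶠ z in 𝓝 x, F z = F x + G (z - x)) : HasHomeoGermAt F x := by
  refine ⟨(Homeomorph.subRight x).trans (G.trans (Homeomorph.addLeft (F x))), ?_⟩
  filter_upwards [h] with z hz
  simpa using hz

theorem exists_homeomorph_eq_linearMap {f : (Fin n → ℝ) →ₗ[ℝ] (Fin n → ℝ)} (hf : f.det ≠ 0) :
    ∃ G : (Fin n → ℝ) ≃ₜ (Fin n → ℝ), ∀ v, G v = f v :=
  ⟨(LinearMap.equivOfDetNeZero f hf).toContinuousLinearEquiv.toHomeomorph, fun _ => rfl⟩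

theorem exists_homeomorph_eq_affMap (hp : p.1.det ≠ 0) :
    ∃ G : (Fin n → ℝ) ≃ₜ (Fin n → ℝ), ∀ v, G v = affMap p v := by
  obtain ⟨G, hG⟩ := exists_homeomorph_eq_linearMap (f := p.1.toLin') (by simpa using hp)
  exact ⟨G.trans (Homeomorph.addRight p.2), fun v => by simp [hG, affMap]⟩

theorem IsPWA.finite_fiber (hF : IsPWA F S) (hS : ∀ p ∈ S, p.1.det ≠ 0) (y : Fin n → ℝ) :
    (F ⁻¹' {y}).Finite := by
  refine (S.finite_toSet.biUnion (t := fun p => affMap p ⁻¹' {y}) fun p hp => ?_).subset ?_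
  · obtain ⟨G, hG⟩ := exists_homeomorph_eq_affMap (hS p hp)
    rw [← funext hG]
    exact (finite_singleton y).preimage G.injective.injOn
  · intro x hx
    obtain ⟨p, hp, hpx⟩ := hF.2 x
    exact mem_biUnion hp (hpx.symm.trans hx)

theorem IsPWA.isClosedMap (hF : IsPWA F S) (hS : ∀ p ∈ S, p.1.det ≠ 0) : IsClosedMap F := by
  refine (isProperMap_iff_isCompact_preimage.2 ⟨hF.1, fun K hK => ?_⟩).isClosedMap
  refine (S.finite_toSet.isCompact_biUnion (f := fun p => affMap p ⁻¹' K)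
    fun p hp => ?_).of_isClosed_subset (hK.isClosed.preimage hF.1) ?_
  · obtain ⟨G, hG⟩ := exists_homeomorph_eq_affMap (hS p hp)
    rw [← funext hG]
    exact G.isCompact_preimage.2 hK
  · intro x hx
    obtain ⟨p, hp, hpx⟩ := hF.2 x
    refine mem_biUnion hp ?_
    rw [mem_preimage, ← hpx]
    exact hx

theorem IsPWA.exists_ball_active (hF : IsPWA F S) (x : Fin n → ℝ) :
    ∃ ε > 0, ∀ z ∈ Metric.ball x ε, ∀ p ∈ S, F z = affMap p z → F x = affMap p x := by
  have h : ∀ᶠ z in 𝓝 x, ∀ p ∈ S, F z = affMap p z → F x = affMap p x := by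
    rw [Filter.eventually_all_finset]
    intro p _
    by_cases hx : F x = affMap p x
    · exact Eventually.of_forall fun _ _ => hx
    · filter_upwards [(isOpen_ne_fun hF.1 (continuous_affMap p)).mem_nhds hx] with z hz hz'
      exact absurd hz' hz
  exact Metric.eventually_nhds_iff_ball.1 h

/-- A piecewise affine map is differentiable at a point only if it is affine nearby. -/
theorem IsPWA.eventually_eq_add_fderiv (hF : IsPWA F S) (hd : DifferentiableAt ℝ F x) :
    ∀ᶠ z in 𝓝 x, F z = F x + fderiv ℝ F x (z - x) := by
  obtain ⟨ε, hε, hact⟩ := hF.exists_ball_active x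
  filter_upwards [Metric.ball_mem_nhds x hε] with z hz
  let c : ℝ → (Fin n → ℝ) := fun t => t⁻¹ • (F (x + t • (z - x)) - F x)
  have hc : ContinuousOn c (Ioc 0 1) := by
    have := hF.1
    refine ContinuousOn.smul (continuousOn_id.inv₀ fun t ht => ht.1.ne') ?_
    fun_prop
  have hfin : (c '' Ioc 0 1).Finite := by
    refine (S.finite_toSet.image fun p => p.1.toLin' (z - x)).subset ?_
    rintro _ ⟨t, ht, rfl⟩
    obtain ⟨p, hp, hpx⟩ := hF.2 (x + t • (z - x))
    refine ⟨p, hp, ?_⟩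
    have hmem : x + t • (z - x) ∈ Metric.ball x ε :=
      (convex_ball x ε).add_smul_sub_mem (Metric.mem_ball_self hε) hz ⟨ht.1.le, ht.2⟩
    simp only [c]
    rw [hpx, hact _ hmem p hp hpx, affMap_sub_affMap, add_sub_cancel_left, map_smul, smul_smul,
      inv_mul_cancel₀ ht.1.ne', one_smul]
  have hsub : (c '' Ioc 0 1).Subsingleton := by
    rw [← not_nontrivial_iff]
    exact fun h => (isPreconnected_Ioc.image c hc).infinite_of_nontrivial h hfin
  have hlim : Tendsto c (𝓝[>] 0) (𝓝 (fderiv ℝ F x (z - x))) :=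
    (hd.hasFDerivAt.hasLineDerivAt (z - x)).tendsto_slope_zero_right
  have hc1 : Tendsto c (𝓝[>] 0) (𝓝 (c 1)) := by
    refine tendsto_const_nhds.congr' ?_
    filter_upwards [Ioc_mem_nhdsGT (zero_lt_one' ℝ)] with t ht
    exact hsub ⟨1, by simp, rfl⟩ ⟨t, ht, rfl⟩
  have := tendsto_nhds_unique hc1 hlim
  rw [← this]
  simp [c]

theorem IsPWA.hasHomeoGermAt_of_differentiableAt (hF : IsPWA F S)
    (hd : DifferentiableAt ℝ F x) (hdet : (fderiv ℝ F x).det ≠ 0) : HasHomeoGermAt F x := by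
  obtain ⟨G, hG⟩ := exists_homeomorph_eq_linearMap
    (f := (fderiv ℝ F x : (Fin n → ℝ) →ₗ[ℝ] (Fin n → ℝ))) hdet
  refine hasHomeoGermAt_of_eventually_eq_add (G := G) ?_
  filter_upwards [hF.eventually_eq_add_fderiv hd] with z hz
  rw [hz, hG]
  rfl

theorem ker_sub_ne_top (hx : affMap p x = affMap q x) (hpq : p ≠ q) :
    LinearMap.ker (p.1.toLin' - q.1.toLin') ≠ ⊤ := by
  intro h
  rw [LinearMap.ker_eq_top, sub_eq_zero, EmbeddingLike.apply_eq_iff_eq] at h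
  refine hpq (Prod.ext h ?_)
  simpa [affMap, h] using hx

/-- If two pairs of distinct affine maps agree at a point and the intersection of the two
coincidence sets is not thin, then the coincidence sets are the same hyperplane. -/
theorem ker_sub_eq_of_not_isThin (hpq : p ≠ q) (hrs : r ≠ s)
    (hx : affMap p x = affMap q x) (hx' : affMap r x = affMap s x)
    (h : ¬ IsThin ({z | affMap p z = affMap q z} ∩ {z | affMap r z = affMap s z})) :
    LinearMap.ker (r.1.toLin' - s.1.toLin') = LinearMap.ker (p.1.toLin' - q.1.toLin') ∧
      n ≤ finrank ℝ (LinearMap.ker (p.1.toLin' - q.1.toLin')) + 1 := by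
  set K := LinearMap.ker (p.1.toLin' - q.1.toLin') with hK
  set L := LinearMap.ker (r.1.toLin' - s.1.toLin') with hL
  have hV : n ≤ finrank ℝ (K ⊓ L : Submodule ℝ (Fin n → ℝ)) + 1 := by
    by_contra hlt
    refine h ⟨K ⊓ L, by rw [finrank_fin_fun]; lia, fun a ha b hb => ⟨?_, ?_⟩⟩
    · rw [hK, SetLike.mem_coe, LinearMap.mem_ker, LinearMap.sub_apply, ← affMap_sub_affMap,
        ← affMap_sub_affMap, show affMap p a = affMap q a from ha.1,
        show affMap p b = affMap q b from hb.1, sub_self]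
    · rw [hL, SetLike.mem_coe, LinearMap.mem_ker, LinearMap.sub_apply, ← affMap_sub_affMap,
        ← affMap_sub_affMap, show affMap r a = affMap s a from ha.2,
        show affMap r b = affMap s b from hb.2, sub_self]
  have hKt : finrank ℝ K < _ := Submodule.finrank_lt (ker_sub_ne_top hx hpq)
  have hLt : finrank ℝ L < _ := Submodule.finrank_lt (ker_sub_ne_top hx' hrs)
  rw [finrank_fin_fun] at hKt hLt
  have h1 : K ⊓ L = K := Submodule.eq_of_le_of_finrank_le inf_le_left (by lia)
  have h2 : K ⊓ L = L := Submodule.eq_of_le_of_finrank_le inf_le_right (by lia)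
  refine ⟨h2.symm.trans h1, ?_⟩
  rwa [h1] at hV

/-- On an open half ball on which distinct active selection functions differ, a piecewise affine
map is affine. -/
theorem IsPWA.exists_eq_affMap_of_pos (hF : IsPWA F S) {ε : ℝ} (hε : 0 < ε)
    (hact : ∀ z ∈ Metric.ball x ε, ∀ p ∈ S, F z = affMap p z → F x = affMap p x)
    {l : (Fin n → ℝ) →ₗ[ℝ] ℝ} (hl0 : l ≠ 0)
    (hl : ∀ p ∈ S, ∀ q ∈ S, F x = affMap p x → F x = affMap q x → p ≠ q →
      ∀ z, affMap p z = affMap q z → l (z - x) = 0) :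
    ∃ p ∈ S, F x = affMap p x ∧ ∀ z ∈ Metric.ball x ε, 0 < l (z - x) → F z = affMap p z := by
  set D : Set (Fin n → ℝ) := Metric.ball x ε ∩ {z | l x < l z}
  have hDc : IsPreconnected D :=
    ((convex_ball x ε).inter (convex_halfSpace_gt l.isLinear (l x))).isPreconnected
  obtain ⟨z₁, hz₁⟩ : D.Nonempty := by
    obtain ⟨u, hu⟩ := DFunLike.ne_iff.1 hl0
    have hu' : 0 < l u * l u := mul_self_pos.2 hu
    have hlim : Tendsto (fun t : ℝ => x + t • (l u • u)) (𝓝[>] 0) (𝓝 x) := by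
      have : Continuous fun t : ℝ => x + t • (l u • u) := by fun_prop
      simpa using (this.tendsto 0).mono_left nhdsWithin_le_nhds
    obtain ⟨t, ht, ht0⟩ := ((hlim.eventually (Metric.ball_mem_nhds x hε)).and
      self_mem_nhdsWithin).exists
    refine ⟨_, ht, ?_⟩
    have : 0 < t * (l u * l u) := mul_pos ht0 hu'
    simpa using this
  obtain ⟨p, hp, hpz⟩ := hF.2 z₁
  refine ⟨p, hp, hact _ hz₁.1 p hp hpz, fun z hz hlz => ?_⟩
  have hzD : z ∈ D := ⟨hz, by simpa using hlz⟩
  by_contra hne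
  obtain ⟨q, hq, hqz⟩ := hF.2 z
  let T : Set (Matrix (Fin n) (Fin n) ℝ × (Fin n → ℝ)) := {q | q ∈ S ∧ q ≠ p}
  have hT : T.Finite := S.finite_toSet.subset fun q hq => hq.1
  obtain ⟨a, haD, hap, haq⟩ := isPreconnected_closed_iff.1 hDc {z | F z = affMap p z}
    (⋃ q ∈ T, {z | F z = affMap q z}) (isClosed_eq hF.1 (continuous_affMap p))
    (hT.isClosed_biUnion fun q _ => isClosed_eq hF.1 (continuous_affMap q))
    (by
      intro a _
      obtain ⟨q, hq, hqa⟩ := hF.2 a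
      by_cases hqp : q = p
      · exact Or.inl (show F a = affMap p a by rw [← hqp, hqa])
      · exact Or.inr (mem_biUnion (show q ∈ T from ⟨hq, hqp⟩) hqa))
    ⟨z₁, hz₁, hpz⟩
    ⟨z, hzD, mem_biUnion (show q ∈ T from ⟨hq, by rintro rfl; exact hne hqz⟩) hqz⟩
  simp only [mem_iUnion] at haq
  obtain ⟨q, ⟨hq, hqp⟩, haq⟩ := haq
  have haq' : F a = affMap q a := haq
  have hap' : F a = affMap p a := hap
  have := hl p hp q hq (hact a haD.1 p hp hap') (hact a haD.1 q hq haq') hqp.symm a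
    (hap'.symm.trans haq')
  have h2 : l x < l a := haD.2
  rw [map_sub] at this
  linarith

/-- A coherently oriented piecewise affine map is a local homeomorphism outside the codimension two
intersections of coincidence sets of its selection functions. -/
theorem IsPWA.hasHomeoGermAt_of_forall_isThin (hF : IsPWA F S)
    (hS : ∀ p ∈ S, ∀ q ∈ S, 0 < p.1.det * q.1.det)
    (hx : ∀ p ∈ S, ∀ q ∈ S, ∀ r ∈ S, ∀ s ∈ S,
      IsThin ({z | affMap p z = affMap q z} ∩ {z | affMap r z = affMap s z}) →
      x ∉ {z | affMap p z = affMap q z} ∩ {z | affMap r z = affMap s z}) :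
    HasHomeoGermAt F x := by
  obtain ⟨ε, hε, hact⟩ := hF.exists_ball_active x
  by_cases h : ∃ p ∈ S, ∃ q ∈ S, F x = affMap p x ∧ F x = affMap q x ∧ p ≠ q
  · obtain ⟨p₀, hp₀, q₀, hq₀, hp₀x, hq₀x, hne₀⟩ := h
    set K := LinearMap.ker (p₀.1.toLin' - q₀.1.toLin') with hK
    have hker : ∀ p ∈ S, ∀ q ∈ S, F x = affMap p x → F x = affMap q x → p ≠ q →
        LinearMap.ker (p.1.toLin' - q.1.toLin') = K ∧ n ≤ finrank ℝ K + 1 := by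
      intro p hp q hq hpx hqx hpq
      have h₀ := hp₀x.symm.trans hq₀x
      have h₁ := hpx.symm.trans hqx
      exact ker_sub_eq_of_not_isThin hne₀ hpq h₀ h₁
        fun ht => hx _ hp₀ _ hq₀ _ hp _ hq ht ⟨h₀, h₁⟩
    obtain ⟨l, hl0, hKl⟩ := K.exists_le_ker_of_lt_top
      (ker_sub_ne_top (hp₀x.symm.trans hq₀x) hne₀).lt_top
    have hlK : K = LinearMap.ker l := by
      refine Submodule.eq_of_le_of_finrank_le hKl ?_
      have h1 := (hker _ hp₀ _ hq₀ hp₀x hq₀x hne₀).2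
      have h2 := Submodule.finrank_lt (mt LinearMap.ker_eq_top.1 hl0)
      rw [finrank_fin_fun] at h2
      lia
    have hagree : ∀ p ∈ S, ∀ q ∈ S, F x = affMap p x → F x = affMap q x → ∀ v, l v = 0 →
        p.1.toLin' v = q.1.toLin' v := by
      intro p hp q hq hpx hqx v hv
      rcases eq_or_ne p q with rfl | hpq
      · rfl
      · have : v ∈ LinearMap.ker (p.1.toLin' - q.1.toLin') := by
          rw [(hker p hp q hq hpx hqx hpq).1, hlK]
          exact hv
        rwa [LinearMap.mem_ker, LinearMap.sub_apply, sub_eq_zero] at this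
    have hzero : ∀ p ∈ S, ∀ q ∈ S, F x = affMap p x → F x = affMap q x → p ≠ q →
        ∀ z, affMap p z = affMap q z → l (z - x) = 0 := by
      intro p hp q hq hpx hqx hpq z hz
      have : z - x ∈ LinearMap.ker (p.1.toLin' - q.1.toLin') := by
        rw [LinearMap.mem_ker, LinearMap.sub_apply, ← affMap_sub_affMap, ← affMap_sub_affMap, hz,
          ← hpx, ← hqx, sub_self]
      rw [(hker p hp q hq hpx hqx hpq).1, hlK] at this
      exact this
    obtain ⟨p, hp, hpx, hpF⟩ := hF.exists_eq_affMap_of_pos hε hact hl0 hzero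
    obtain ⟨q, hq, hqx, hqF⟩ := hF.exists_eq_affMap_of_pos hε hact (neg_ne_zero.2 hl0)
      (fun p hp q hq hpx hqx hpq z hz => by simp [hzero p hp q hq hpx hqx hpq z hz])
    obtain ⟨G, hGp, hGq⟩ := exists_homeomorph_glue p.1.toLin' q.1.toLin'
      (by simpa using hS p hp q hq) l (hagree p hp q hq hpx hqx)
    refine hasHomeoGermAt_of_eventually_eq_add (G := G) ?_
    filter_upwards [Metric.ball_mem_nhds x hε] with z hz
    rcases lt_trichotomy (l (z - x)) 0 with hlz | hlz | hlz
    · rw [hGq _ hlz.le, hqF z hz (by simpa using hlz), affMap_eq_add q x z, hqx]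
    · obtain ⟨r, hr, hrz⟩ := hF.2 z
      have hrx := hact z hz r hr hrz
      rw [hGp _ hlz.ge, hrz, affMap_eq_add r x z, hrx, hagree r hr p hp hrx hpx _ hlz]
    · rw [hGp _ hlz.le, hpF z hz hlz, affMap_eq_add p x z, hpx]
  · push Not at h
    obtain ⟨p, hp, hpx⟩ := hF.2 x
    obtain ⟨G, hG⟩ := exists_homeomorph_eq_affMap (left_ne_zero_of_mul (hS p hp p hp).ne')
    refine ⟨G, ?_⟩
    filter_upwards [Metric.ball_mem_nhds x hε] with z hz
    obtain ⟨q, hq, hqz⟩ := hF.2 z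
    rw [hG, h p hp q hq hpx (hact z hz q hq hqz), hqz]

theorem IsPWA.ncard_fiber_eq (hF : IsPWA F S) (hS : ∀ p ∈ S, ∀ q ∈ S, 0 < p.1.det * q.1.det)
    {y₀ y₁ : Fin n → ℝ} (h₀ : ∀ x, F x = y₀ → HasHomeoGermAt F x)
    (h₁ : ∀ x, F x = y₁ → HasHomeoGermAt F x) :
    (F ⁻¹' {y₀}).ncard = (F ⁻¹' {y₁}).ncard := by
  have hS' : ∀ p ∈ S, p.1.det ≠ 0 := fun p hp => left_ne_zero_of_mul (hS p hp p hp).ne'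
  have hloc : ∀ y, (∀ x, F x = y → HasHomeoGermAt F x) →
      ∀ᶠ y' in 𝓝 y, (F ⁻¹' {y'}).ncard = (F ⁻¹' {y}).ncard := fun y hy =>
    (hF.isClosedMap hS').eventually_ncard_fiber_eq (hF.finite_fiber hS' y) hy
  let 𝓜 : Set (Set (Fin n → ℝ)) := {M | IsThin M} ∩
    (fun i : (Matrix (Fin n) (Fin n) ℝ × (Fin n → ℝ)) × (Matrix (Fin n) (Fin n) ℝ × (Fin n → ℝ)) ×
        (Matrix (Fin n) (Fin n) ℝ × (Fin n → ℝ)) × (Matrix (Fin n) (Fin n) ℝ × (Fin n → ℝ)) ×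
        (Matrix (Fin n) (Fin n) ℝ × (Fin n → ℝ)) =>
      affMap i.1 '' ({z | affMap i.2.1 z = affMap i.2.2.1 z} ∩
        {z | affMap i.2.2.2.1 z = affMap i.2.2.2.2 z})) ''
      ((S : Set _) ×ˢ (S : Set _) ×ˢ (S : Set _) ×ˢ (S : Set _) ×ˢ (S : Set _))
  have h𝓜 : 𝓜.Finite := by
    refine Finite.inter_of_right (Finite.image _ ?_) _
    have := S.finite_toSet
    exact this.prod (this.prod (this.prod (this.prod this)))
  have hgood : ∀ y, (∀ M ∈ 𝓜, y ∉ M) → ∀ x, F x = y → HasHomeoGermAt F x := by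
    rintro y hy x rfl
    refine hF.hasHomeoGermAt_of_forall_isThin hS fun p hp q hq r hr s hs ht hx => ?_
    obtain ⟨o, ho, hox⟩ := hF.2 x
    exact hy _ ⟨ht.image _ o.1.toLin' (affMap_sub_affMap o),
      ⟨(o, p, q, r, s), ⟨ho, hp, hq, hr, hs⟩, rfl⟩⟩ ⟨x, hx, hox.symm⟩
  have hdense : Dense {y : Fin n → ℝ | ∀ M ∈ 𝓜, y ∉ M} :=
    Measure.dense_of_ae (μ := volume)
      ((ae_ball_iff h𝓜.countable).2 fun M hM => hM.1.ae_notMem volume)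
  have hseg : ∀ y : Fin n → ℝ, (∀ M ∈ 𝓜, y ∉ M) →
      ∀ᵐ z, (F ⁻¹' {y}).ncard = (F ⁻¹' {z}).ncard := by
    intro y hy
    filter_upwards [(ae_ball_iff h𝓜.countable).2
      fun M hM => hM.1.ae_disjoint_segment volume (hy M hM)] with z hz
    refine (convex_segment (𝕜 := ℝ) y z).isPreconnected.induction₂
      (fun a b => (F ⁻¹' {a}).ncard = (F ⁻¹' {b}).ncard) (fun a ha => ?_)
      (fun _ _ _ _ _ _ => Eq.trans) (fun _ _ _ _ => Eq.symm) (left_mem_segment ℝ y z)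
      (right_mem_segment ℝ y z)
    refine nhdsWithin_le_nhds ((hloc a (hgood a fun M hM => ?_)).mono fun _ => Eq.symm)
    exact Set.disjoint_left.1 (hz M hM) ha
  obtain ⟨y₀', hy₀', hm₀⟩ := hdense.inter_nhds_nonempty (hloc y₀ h₀)
  obtain ⟨y₁', hy₁', hm₁⟩ := hdense.inter_nhds_nonempty (hloc y₁ h₁)
  obtain ⟨z, hz₀, hz₁⟩ := ((hseg y₀' hy₀').and (hseg y₁' hy₁')).exists
  exact hm₀.symm.trans (hz₀.trans (hz₁.symm.trans hm₁))

end Affine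

/-- A coherently oriented piecewise affine function `F : ℝⁿ → ℝⁿ` has
the same finite number of preimages over every regular value. -/
theorem regular_values_have_same_card_of_coherently_oriented
    {n : ℕ} (F : (Fin n → ℝ) → (Fin n → ℝ))
    (S : Finset (Matrix (Fin n) (Fin n) ℝ × (Fin n → ℝ)))
    (hF : IsPWA F S)
    (hco : (∀ p ∈ S, 0 < p.1.det) ∨ (∀ p ∈ S, p.1.det < 0)) :
    ∃ k : ℕ, ∀ y : Fin n → ℝ, IsRegularValue F y →
      (F ⁻¹' {y}).Finite ∧ (F ⁻¹' {y}).ncard = k := by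
  have hS : ∀ p ∈ S, ∀ q ∈ S, 0 < p.1.det * q.1.det := by
    rcases hco with h | h
    · exact fun p hp q hq => mul_pos (h p hp) (h q hq)
    · exact fun p hp q hq => mul_pos_of_neg_of_neg (h p hp) (h q hq)
  have hfin := hF.finite_fiber fun p hp => left_ne_zero_of_mul (hS p hp p hp).ne'
  have hreg : ∀ y, IsRegularValue F y → ∀ x, F x = y → HasHomeoGermAt F x := fun y hy x hx =>
    hF.hasHomeoGermAt_of_differentiableAt (hy x hx).1 (hy x hx).2
  by_cases h : ∃ y₀, IsRegularValue F y₀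
  · obtain ⟨y₀, hy₀⟩ := h
    exact ⟨(F ⁻¹' {y₀}).ncard, fun y hy =>
      ⟨hfin y, hF.ncard_fiber_eq hS (hreg y hy) (hreg y₀ hy₀)⟩⟩
  · exact ⟨0, fun y hy => absurd ⟨y, hy⟩ h⟩
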